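/- arXiv:2512.19363 — 3 statements merged into one kernel-verified Lean document; each statement's English description precedes it below -/
import Mathlib

section
/- For a finite set N of n players, a characteristic function v : Finset N → ℝ, and any player i ∈ N, the average over all n! permutations of N of the marginal contribution of i equals the combinatorial Shapley formula: (1/n!) ∑_{π} [v(Pre_π(i) ∪ {i}) − v(Pre_π(i))] = ∑_{S ⊆ N \ {i}} (|S|! · (n − |S| − 1)! / n!) · [v(S ∪ {i}) − v(S)]. -/
open Finset

variable {α : Type*} [Fintype α] [DecidableEq α]

/-- The predecessor set of player `i` under the ordering (permutation) `π`. -/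
def pre (π : α ≃ Fin (Fintype.card α)) (i : α) : Finset α :=
  Finset.univ.filter (fun j => π j < π i)

/-- Marginal contribution of player `i` under permutation `π`. -/
noncomputable def marginal (v : Finset α → ℝ) (π : α ≃ Fin (Fintype.card α)) (i : α) : ℝ :=
  v (insert i (pre π i)) - v (pre π i)

/-- The Shapley value of player `i`. -/
noncomputable def shapley (v : Finset α → ℝ) (i : α) : ℝ :=
  (1 / (Nat.factorial (Fintype.card α) : ℝ)) *
    ∑ π : α ≃ Fin (Fintype.card α), marginal v π i

theorem card_pre_aux (π : α ≃ Fin (Fintype.card α)) (i : α) : (pre π i).card = (π i : ℕ) := by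
  have h : (pre π i).map π.toEmbedding = Finset.Iio (π i) := by
    ext x
    simp only [pre, Finset.mem_map, Finset.mem_filter, Finset.mem_univ, true_and, Finset.mem_Iio]
    constructor
    · rintro ⟨a, ha, rfl⟩
      exact ha
    · intro hx
      exact ⟨π.symm x, by simpa using hx, by simp⟩
  rw [← Finset.card_map π.toEmbedding, h, Fin.card_Iio]

theorem pre_eq_iff_aux (π : α ≃ Fin (Fintype.card α)) (i : α) (S : Finset α) :
    pre π i = S ↔ (Numbering.IsPrefix π S ∧ (π i : ℕ) = S.card) := by
  constructor
  · rintro rfl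
    refine ⟨?_, (card_pre_aux π i).symm⟩
    intro x
    rw [card_pre_aux]
    simp [pre]
  · rintro ⟨h, hi⟩
    ext x
    rw [h x, ← hi]
    simp [pre]

theorem card_fiber_eq_aux (S : Finset α) (i j : α) (hi : i ∉ S) (hj : j ∉ S) :
    (Finset.univ.filter (fun π : α ≃ Fin (Fintype.card α) => pre π j = S)).card =
    (Finset.univ.filter (fun π : α ≃ Fin (Fintype.card α) => pre π i = S)).card := by
  have key : ∀ a b : α, a ∉ S → b ∉ S → ∀ π : α ≃ Fin (Fintype.card α), pre π a = S →
      pre ((Equiv.swap a b).trans π) b = S := by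
    intro a b ha hb π h
    rw [pre_eq_iff_aux] at h ⊢
    refine ⟨?_, by simpa using h.2⟩
    intro x
    have h1 := h.1 (Equiv.swap a b x)
    rw [Equiv.trans_apply, ← h1]
    by_cases hxa : x = a
    · subst hxa; simp [ha, hb]
    by_cases hxb : x = b
    · subst hxb; simp [ha, hb]
    rw [Equiv.swap_apply_of_ne_of_ne hxa hxb]
  refine Finset.card_bij' (fun π _ => (Equiv.swap j i).trans π)
    (fun π _ => (Equiv.swap i j).trans π) ?_ ?_ ?_ ?_
  · intro π h
    simpa using key j i hj hi π (by simpa using h)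
  · intro π h
    simpa using key i j hi hj π (by simpa using h)
  · intro π _
    ext x
    simp [Equiv.swap_comm i j]
  · intro π _
    ext x
    simp [Equiv.swap_comm i j]

theorem card_fiber_aux (S : Finset α) (i : α) (hi : i ∉ S) :
    (Finset.univ.filter (fun π : α ≃ Fin (Fintype.card α) => pre π i = S)).card =
    Nat.factorial S.card * Nat.factorial (Fintype.card α - S.card - 1) := by
  have hlt : S.card < Fintype.card α := Finset.card_lt_univ_of_notMem hi
  have h1 : (Numbering.prefixed S).card =
      ∑ j ∈ Sᶜ, (Finset.univ.filter (fun π : α ≃ Fin (Fintype.card α) => pre π j = S)).card := by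
    rw [Finset.card_eq_sum_card_fiberwise (f := fun π : Numbering α => π.symm ⟨S.card, hlt⟩)
      (t := Sᶜ)]
    · refine Finset.sum_congr rfl fun j _ => ?_
      congr 1
      ext π
      simp only [Finset.mem_filter, Numbering.mem_prefixed, Finset.mem_univ, true_and,
        pre_eq_iff_aux, Equiv.symm_apply_eq, Fin.ext_iff]
      exact and_congr_right fun _ => eq_comm
    · intro π h
      have h' : Numbering.IsPrefix π S := by simpa using h
      simp [h' _]
  rw [Finset.sum_congr rfl (fun j hj => card_fiber_eq_aux S i j hi (by simpa using hj)),
    Finset.sum_const, Numbering.card_prefixed, Finset.card_compl, smul_eq_mul] at h1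
  obtain ⟨m, hm⟩ : ∃ m, Fintype.card α - S.card = m + 1 := ⟨Fintype.card α - S.card - 1, by omega⟩
  rw [hm, Nat.factorial_succ] at h1
  rw [hm, Nat.add_sub_cancel]
  apply Nat.eq_of_mul_eq_mul_left (Nat.succ_pos m)
  rw [Nat.succ_eq_add_one, ← h1]
  ring

/-- The permutation-average definition of the Shapley value equals the
combinatorial Shapley formula. -/
theorem shapley_perm_eq_combinatorial (v : Finset α → ℝ) (i : α) :
    (1 / (Nat.factorial (Fintype.card α) : ℝ)) *
        ∑ π : α ≃ Fin (Fintype.card α), marginal v π i =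
      ∑ S ∈ ((Finset.univ : Finset α).erase i).powerset,
        ((Nat.factorial S.card : ℝ) * (Nat.factorial (Fintype.card α - S.card - 1) : ℝ) /
            (Nat.factorial (Fintype.card α) : ℝ)) * (v (insert i S) - v S) := by
  have hmaps : ∀ π ∈ (Finset.univ : Finset (α ≃ Fin (Fintype.card α))),
      pre π i ∈ ((Finset.univ : Finset α).erase i).powerset := by
    intro π _
    rw [Finset.mem_powerset]
    intro x hx
    simp only [pre, Finset.mem_filter, Finset.mem_univ, true_and] at hx
    rw [Finset.mem_erase]
    refine ⟨?_, Finset.mem_univ _⟩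
    rintro rfl
    exact lt_irrefl _ hx
  rw [← Finset.sum_fiberwise_of_maps_to hmaps, Finset.mul_sum]
  refine Finset.sum_congr rfl fun S hS => ?_
  have hi : i ∉ S := fun h => by simpa using Finset.mem_powerset.mp hS h
  have hc : ∀ π ∈ Finset.univ.filter (fun π : α ≃ Fin (Fintype.card α) => pre π i = S),
      marginal v π i = v (insert i S) - v S := by
    intro π h
    have h' : pre π i = S := by simpa using h
    rw [marginal, h']
  rw [Finset.sum_congr rfl hc, Finset.sum_const, card_fiber_aux S i hi, nsmul_eq_mul]
  push_cast
  ring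
end

section
/- (Efficiency axiom.) For a finite set N of n players and any characteristic function v : Finset N → ℝ, the Shapley values sum to the total surplus: ∑_{i ∈ N} ψ_i(v) = v(N) − v(∅). -/
open Finset

variable {α : Type*} [Fintype α] [DecidableEq α]

theorem sum_marginal (v : Finset α → ℝ) (π : α ≃ Fin (Fintype.card α)) :
    ∑ i : α, marginal v π i = v Finset.univ - v ∅ := by
  let f : ℕ → ℝ := fun k => v (Finset.univ.filter (fun j => (π j : ℕ) < k))
  have h1 : ∀ i, marginal v π i = f ((π i : ℕ) + 1) - f (π i : ℕ) := by
    intro i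
    have h2 : insert i (pre π i) = Finset.univ.filter (fun j => (π j : ℕ) < (π i : ℕ) + 1) := by
      ext j
      simp only [pre, Finset.mem_insert, Finset.mem_filter, Finset.mem_univ, true_and]
      rw [← π.apply_eq_iff_eq (x := j) (y := i), Fin.ext_iff, Fin.lt_def]
      omega
    have h3 : pre π i = Finset.univ.filter (fun j => (π j : ℕ) < (π i : ℕ)) := by
      ext j
      simp [pre]
    simp only [marginal, f, h2]
    rw [h3]
  rw [Finset.sum_congr rfl (fun i _ => h1 i),
    Equiv.sum_comp π (fun k : Fin (Fintype.card α) => f ((k : ℕ) + 1) - f (k : ℕ)),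
    Fin.sum_univ_eq_sum_range (fun k => f (k + 1) - f k), Finset.sum_range_sub]
  simp [f]

/-- Efficiency axiom: Shapley values sum to the total surplus. -/
theorem shapley_efficiency (v : Finset α → ℝ) :
    ∑ i : α, shapley v i = v Finset.univ - v ∅ := by
  simp only [shapley]
  rw [← Finset.mul_sum, Finset.sum_comm, Finset.sum_congr rfl (fun π _ => sum_marginal v π),
    Finset.sum_const, Finset.card_univ, Fintype.card_equiv (Fintype.equivFin α), nsmul_eq_mul]
  have : ((Fintype.card α).factorial : ℝ) ≠ 0 := by positivity
  field_simp
end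

section
/- (Symmetry axiom.) Let N be a finite set of n players and v : Finset N → ℝ a characteristic function. If two distinct players i, j ∈ N satisfy v(S ∪ {i}) = v(S ∪ {j}) for every subset S ⊆ N \ {i, j}, then ψ_i(v) = ψ_j(v). -/
open Finset

variable {α : Type*} [Fintype α] [DecidableEq α]

theorem v_swap_image (v : Finset α → ℝ) (i j : α) (hij : i ≠ j)
    (hsym : ∀ S : Finset α, i ∉ S → j ∉ S → v (insert i S) = v (insert j S))
    (S : Finset α) : v (S.image (Equiv.swap i j)) = v S := by
  have hmem : ∀ x, x ∈ S.image (Equiv.swap i j) ↔ Equiv.swap i j x ∈ S := by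
    intro x
    rw [Finset.mem_image]
    constructor
    · rintro ⟨y, hy, rfl⟩
      simpa using hy
    · intro h
      exact ⟨_, h, by simp⟩
  by_cases hi : i ∈ S <;> by_cases hj : j ∈ S
  · congr 1
    ext x
    rw [hmem, Equiv.swap_apply_def]
    split_ifs <;> simp_all
  · have h1 : S = insert i ((S.erase i).erase j) := by
      ext x; simp only [mem_insert, mem_erase]; grind
    have h2 : S.image (Equiv.swap i j) = insert j ((S.erase i).erase j) := by
      ext x
      rw [hmem, Equiv.swap_apply_def]
      simp only [mem_insert, mem_erase]; grind
    rw [h2, ← hsym _ (by simp) (by simp), ← h1]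
  · have h1 : S = insert j ((S.erase i).erase j) := by
      ext x; simp only [mem_insert, mem_erase]; grind
    have h2 : S.image (Equiv.swap i j) = insert i ((S.erase i).erase j) := by
      ext x
      rw [hmem, Equiv.swap_apply_def]
      simp only [mem_insert, mem_erase]; grind
    rw [h2, hsym _ (by simp) (by simp), ← h1]
  · congr 1
    ext x
    rw [hmem, Equiv.swap_apply_def]
    split_ifs <;> simp_all

/-- Symmetry axiom: interchangeable players receive equal Shapley value. -/
theorem shapley_symmetry (v : Finset α → ℝ) (i j : α) (hij : i ≠ j)
    (hsym : ∀ S : Finset α, i ∉ S → j ∉ S → v (insert i S) = v (insert j S)) :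
    shapley v i = shapley v j := by
  unfold shapley
  congr 1
  refine Fintype.sum_equiv (Equiv.equivCongr (Equiv.swap i j) (Equiv.refl _)) _ _ ?_
  intro π
  have hpre : pre (Equiv.equivCongr (Equiv.swap i j) (Equiv.refl _) π) j
      = (pre π i).image (Equiv.swap i j) := by
    ext x
    simp only [pre, mem_filter, mem_univ, true_and, mem_image, Equiv.equivCongr_apply_apply,
      Equiv.symm_swap, Equiv.swap_apply_right, Equiv.refl_apply]
    constructor
    · intro h
      exact ⟨_, h, by simp⟩
    · rintro ⟨y, hy, rfl⟩
      simpa using hy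
  have hins : insert j ((pre π i).image (Equiv.swap i j))
      = (insert i (pre π i)).image (Equiv.swap i j) := by
    rw [Finset.image_insert, Equiv.swap_apply_left]
  unfold marginal
  rw [hpre, hins, v_swap_image v i j hij hsym, v_swap_image v i j hij hsym]
end
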